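/- Let L : ℝ^m × ℝ^n × ℝ^{n×m} → ℝ be a smooth first-order Lagrangian and let ξ : ℝ^n → ℝ^n be a smooth vector field on the fiber which is an infinitesimal symmetry of L, i.e. for all (x,u,w): Σ_a (∂L/∂u^a)(x,u,w) ξ^a(u) + Σ_{a,b,k} (∂L/∂w^a_k)(x,u,w) (∂ξ^a/∂u^b)(u) w^b_k = 0. If a smooth field u : ℝ^m → ℝ^n satisfies the Euler–Lagrange equations of L, then the momentum current J^k(x) = Σ_a (∂L/∂w^a_k)(j¹u(x)) ξ^a(u(x)) is divergence-free: Σ_{k=1}^m ∂J^k/∂x^k(x) = 0 for all x. (Noether's theorem: the momentum map is conserved along solutions of the Lagrangian field theory.) -/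

import Mathlib

noncomputable section

/-- The first-jet space of the trivial bundle `ℝ^m × ℝ^n → ℝ^m`. -/
abbrev Jet (m n : ℕ) := (Fin m → ℝ) × (Fin n → ℝ) × (Fin n → Fin m → ℝ)

/-- Partial derivative `∂f/∂x^k` of a scalar function on `ℝ^m`. -/
def pd {m : ℕ} (f : (Fin m → ℝ) → ℝ) (k : Fin m) (x : Fin m → ℝ) : ℝ :=
  fderiv ℝ f x (Pi.single k 1)

/-- Partial derivative `∂L/∂u^a`. -/
def dLu {m n : ℕ} (L : Jet m n → ℝ) (q : Jet m n) (a : Fin n) : ℝ :=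
  fderiv ℝ L q (0, Pi.single a 1, 0)

/-- Partial derivative `∂L/∂w^a_k`. -/
def dLw {m n : ℕ} (L : Jet m n → ℝ) (q : Jet m n) (a : Fin n) (k : Fin m) : ℝ :=
  fderiv ℝ L q (0, 0, Pi.single a (Pi.single k 1))

/-- The first jet prolongation `j¹u(x) = (x, u(x), Du(x))`. -/
def J1 {m n : ℕ} (u : (Fin m → ℝ) → Fin n → ℝ) (x : Fin m → ℝ) : Jet m n :=
  (x, u x, fun a k => pd (fun y => u y a) k x)

theorem contDiff_fderiv_apply_const {E F : Type*} [NormedAddCommGroup E] [NormedSpace ℝ E]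
    [NormedAddCommGroup F] [NormedSpace ℝ F] {f : E → F} (hf : ContDiff ℝ (⊤ : ℕ∞) f) (v : E) :
    ContDiff ℝ (⊤ : ℕ∞) (fun x => fderiv ℝ f x v) :=
  (hf.fderiv_right (m := (⊤ : ℕ∞)) (by simp)).clm_apply contDiff_const

theorem contDiff_J1 {m n : ℕ} {u : (Fin m → ℝ) → Fin n → ℝ} (hu : ContDiff ℝ (⊤ : ℕ∞) u) :
    ContDiff ℝ (⊤ : ℕ∞) (J1 u) :=
  contDiff_id.prodMk <| hu.prodMk <| contDiff_pi.2 fun a => contDiff_pi.2 fun k =>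
    contDiff_fderiv_apply_const (contDiff_pi.1 hu a) (Pi.single k 1)

theorem contDiff_dLw_J1 {m n : ℕ} {L : Jet m n → ℝ} (hL : ContDiff ℝ (⊤ : ℕ∞) L)
    {u : (Fin m → ℝ) → Fin n → ℝ} (hu : ContDiff ℝ (⊤ : ℕ∞) u) (a : Fin n) (k : Fin m) :
    ContDiff ℝ (⊤ : ℕ∞) (fun y => dLw L (J1 u y) a k) :=
  (contDiff_fderiv_apply_const hL _).comp (contDiff_J1 hu)

theorem pd_sum_mul {m : ℕ} {ι : Type*} [Fintype ι] {f g : ι → (Fin m → ℝ) → ℝ}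
    (hf : ∀ i, Differentiable ℝ (f i)) (hg : ∀ i, Differentiable ℝ (g i))
    (k : Fin m) (x : Fin m → ℝ) :
    pd (fun y => ∑ i, f i y * g i y) k x
      = ∑ i, (pd (f i) k x * g i x + f i x * pd (g i) k x) := by
  unfold pd
  rw [fderiv_fun_sum fun i _ => (hf i x).fun_mul (hg i x)]
  simp only [_root_.sum_apply]
  refine Finset.sum_congr rfl fun i _ => ?_
  rw [fderiv_fun_mul (hf i x) (hg i x)]
  simp
  ring

theorem pd_comp {m n : ℕ} {g : (Fin n → ℝ) → ℝ} (hg : Differentiable ℝ g)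
    {u : (Fin m → ℝ) → Fin n → ℝ} (hu : Differentiable ℝ u) (k : Fin m) (x : Fin m → ℝ) :
    pd (fun y => g (u y)) k x
      = ∑ b, fderiv ℝ g (u x) (Pi.single b 1) * pd (fun y => u y b) k x := by
  have h : fderiv ℝ (fun y => g (u y)) x = (fderiv ℝ g (u x)).comp (fderiv ℝ u x) :=
    fderiv_comp x (hg (u x)) (hu x)
  have hb (b : Fin n) : pd (fun y => u y b) k x = fderiv ℝ u x (Pi.single k 1) b := by
    unfold pd
    rw [fderiv_apply (hu x) b]
    rfl
  simp only [hb]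
  unfold pd
  rw [h, ContinuousLinearMap.comp_apply]
  conv_lhs => rw [pi_eq_sum_univ' (fderiv ℝ u x (Pi.single k 1))]
  rw [map_sum]
  refine Finset.sum_congr rfl fun b _ => ?_
  rw [map_smul, smul_eq_mul, mul_comm]

/-- Noether's theorem: if the vertical vector field `ξ` is an infinitesimal symmetry of `L`,
then along any solution `u` of the Euler–Lagrange equations the momentum current
`J^k = Σ_a (∂L/∂w^a_k)(j¹u) ξ^a(u)` is divergence-free. -/
theorem statement2 {m n : ℕ}
    (L : Jet m n → ℝ) (hL : ContDiff ℝ (⊤ : ℕ∞) L)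
    (ξ : (Fin n → ℝ) → Fin n → ℝ) (hξ : ContDiff ℝ (⊤ : ℕ∞) ξ)
    (hinv : ∀ (x : Fin m → ℝ) (v : Fin n → ℝ) (w : Fin n → Fin m → ℝ),
       (∑ a, dLu L (x, v, w) a * ξ v a)
       + (∑ a, ∑ k, dLw L (x, v, w) a k *
            (∑ b, fderiv ℝ (fun v' => ξ v' a) v (Pi.single b 1) * w b k)) = 0)
    (u : (Fin m → ℝ) → Fin n → ℝ) (hu : ContDiff ℝ (⊤ : ℕ∞) u)
    (hEL : ∀ (x : Fin m → ℝ) (a : Fin n),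
       (∑ k, pd (fun y => dLw L (J1 u y) a k) k x) = dLu L (J1 u x) a) :
    ∀ x : Fin m → ℝ,
      (∑ k, pd (fun y => ∑ a, dLw L (J1 u y) a k * ξ (u y) a) k x) = 0 := by
  intro x
  have hu' : Differentiable ℝ u := hu.differentiable (by simp)
  have hξ' (a : Fin n) : Differentiable ℝ fun v => ξ v a :=
    (contDiff_pi.1 hξ a).differentiable (by simp)
  have hp (a : Fin n) (k : Fin m) : Differentiable ℝ fun y => dLw L (J1 u y) a k :=
    (contDiff_dLw_J1 hL hu a k).differentiable (by simp)
  have hpd (k : Fin m) := pd_sum_mul (fun a => hp a k) (fun a => (hξ' a).comp hu') k x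
  simp only [Function.comp_def] at hpd
  simp only [hpd, pd_comp (hξ' _) hu']
  rw [Finset.sum_comm]
  simp only [Finset.sum_add_distrib, ← Finset.sum_mul, hEL]
  exact hinv x (u x) fun a k => pd (fun y => u y a) k x
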